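/- arXiv:math/0407019 — 2 statements merged into one kernel-verified Lean document; each statement's English description precedes it below -/
import Mathlib

section
/- Let F : 𝒞̄ → 𝒞 be a full additive functor between preadditive categories with Ker(F)ⁿ = 0 for some n ≥ 1, meaning that any composite of n composable morphisms of 𝒞̄ each of which is sent to 0 by F is itself 0. Let (C•,d) be a cochain complex in 𝒞 with a graded lift C̄• along F. Then for every cochain complex (D̄•,d̄_D) in 𝒞̄ with a homotopy equivalence φ : (C•,d) → F(D̄•,d̄_D), there exists a differential d̄ on C̄• with F(d̄) = d such that (C̄•,d̄) is homotopy equivalent to (D̄•,d̄_D) via a homotopy equivalence whose image under F is homotopic to φ; moreover two differentials d̄, d̄′ on C̄• lifting d yield the same isomorphism class of lift along K(F) if and only if there is an isomorphism of complexes (C̄•,d̄) → (C̄•,d̄′) sent by F to a cochain map homotopic to the identity of (C•,d). In other words, the natural functor from differentials on C̄• lifting d to lifts of (C•,d) along K(F) induces a bijection on isomorphism classes. -/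
open CategoryTheory

namespace Paper

/-- A graded object: a `ℤ`-indexed family of objects. -/
abbrev GradedObj (A : Type*) [Category A] := ℤ → A

/-- A graded map of degree `n` from `X` to `Y`. -/
abbrev GMap {A : Type*} [Category A] (X Y : GradedObj A) (n : ℤ) :=
  ∀ i : ℤ, X i ⟶ Y (i + n)

/-- Composition of graded maps, in diagrammatic order (`gcomp h f g` is "`g ∘ f`"),
with prescribed total degree `k = n + m`. -/
def gcomp {A : Type*} [Category A] {X Y Z : GradedObj A} {n m k : ℤ} (h : n + m = k)
    (f : GMap X Y n) (g : GMap Y Z m) : GMap X Z k :=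
  fun i => f i ≫ g (i + n) ≫ eqToHom (congrArg Z (show i + n + m = i + k by omega))

/-- The identity graded map of degree `0`. -/
def gid {A : Type*} [Category A] (X : GradedObj A) : GMap X X 0 :=
  fun i => eqToHom (congrArg X (add_zero i).symm)

/-- `δ(f) = d_Y ∘ f - (-1)ⁿ ⬝ f ∘ d_X` for pre-differentials `d_X`, `d_Y` and a graded
map `f` of degree `n`; the result has degree `m = n + 1`. -/
def gdelta {A : Type*} [Category A] [Preadditive A] {X Y : GradedObj A}
    (dX : GMap X X 1) (dY : GMap Y Y 1) {n m : ℤ} (h : n + 1 = m) (f : GMap X Y n) :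
    GMap X Y m :=
  gcomp h f dY - (n.negOnePow : ℤ) • gcomp (show 1 + n = m by omega) dX f

/-- The image of a graded object under a functor. -/
abbrev Fgr {A B : Type*} [Category A] [Category B] (F : B ⥤ A) (X : GradedObj B) :
    GradedObj A := fun i => F.obj (X i)

/-- The image of a graded map under a functor. -/
def Fmap {A B : Type*} [Category A] [Category B] (F : B ⥤ A) {X Y : GradedObj B} {n : ℤ}
    (f : GMap X Y n) : GMap (Fgr F X) (Fgr F Y) n := fun i => F.map (f i)

/-- `Ker(F)² = 0`: the composite of two `F`-killed morphisms vanishes. -/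
def KerSq {A B : Type*} [Category A] [Category B] [Preadditive A] [Preadditive B]
    (F : B ⥤ A) : Prop :=
  ∀ ⦃X Y Z : B⦄ (u : X ⟶ Y) (v : Y ⟶ Z), F.map u = 0 → F.map v = 0 → u ≫ v = 0

/-- `f : (X,dX) → (Y,dY)` and `g : (Y,dY) → (X,dX)` are cochain maps which are homotopy
inverse to each other. -/
def IsHomotopyEquivPair {A : Type*} [Category A] [Preadditive A] {X Y : GradedObj A}
    (dX : GMap X X 1) (dY : GMap Y Y 1) (f : GMap X Y 0) (g : GMap Y X 0) : Prop :=
  gdelta dX dY (show (0:ℤ) + 1 = 1 by omega) f = 0 ∧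
  gdelta dY dX (show (0:ℤ) + 1 = 1 by omega) g = 0 ∧
  (∃ H : GMap X X (-1), gdelta dX dX (show (-1:ℤ) + 1 = 0 by omega) H
      = gid X - gcomp (show (0:ℤ) + 0 = 0 by omega) f g) ∧
  (∃ K : GMap Y Y (-1), gdelta dY dY (show (-1:ℤ) + 1 = 0 by omega) K
      = gid Y - gcomp (show (0:ℤ) + 0 = 0 by omega) g f)


/-- The composite of a chain of `n` composable morphisms. -/
def chainComp {B : Type*} [Category B] (X : ℕ → B) (f : ∀ i, X i ⟶ X (i + 1)) :
    ∀ n : ℕ, X 0 ⟶ X n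
  | 0 => 𝟙 (X 0)
  | n + 1 => chainComp X f n ≫ f n

/-- `Ker(F)ⁿ = 0`: every composite of `n` composable `F`-killed morphisms vanishes. -/
def KerPow {A B : Type*} [Category A] [Category B] [Preadditive A] [Preadditive B]
    (F : B ⥤ A) (n : ℕ) : Prop :=
  ∀ (X : ℕ → B) (f : ∀ i, X i ⟶ X (i + 1)),
    (∀ i, i < n → F.map (f i) = 0) → chainComp X f n = 0


section Representation

/-- The graded objects of `B`, as the objects of a preadditive category in which the graded maps
of all degrees embed; identities between composites of graded maps can be checked there
without keeping track of degrees. -/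
structure GRep (B : Type*) [Category B] where
  /-- The underlying graded object. -/
  obj : GradedObj B

variable {B : Type*} [Category B] [Preadditive B]

instance : Category (GRep B) where
  Hom X Y := (∀ (i : ℤ) (T : B), Y.obj i ⟶ T) →+ (∀ (i : ℤ) (T : B), X.obj i ⟶ T)
  id _ := AddMonoidHom.id _
  comp f g := AddMonoidHom.comp f g

instance : Preadditive (GRep B) where
  homGroup X Y :=
    inferInstanceAs (AddCommGroup
      ((∀ (i : ℤ) (T : B), Y.obj i ⟶ T) →+ (∀ (i : ℤ) (T : B), X.obj i ⟶ T)))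
  add_comp _ _ _ _ _ _ := rfl
  comp_add _ _ _ f g g' := AddMonoidHom.comp_add f g g'

variable {X Y Z : GradedObj B}

/-- A graded map acts by precomposition on families of morphisms out of its target. -/
def rho {n : ℤ} (f : GMap X Y n) : GRep.mk X ⟶ GRep.mk Y :=
  show (∀ (i : ℤ) (T : B), Y i ⟶ T) →+ (∀ (i : ℤ) (T : B), X i ⟶ T) from
  { toFun := fun y i T => f i ≫ y (i + n) T
    map_zero' := by ext i T; simp
    map_add' := fun y z => by ext i T; simp }

lemma rho_injective {n : ℤ} : Function.Injective (rho : GMap X Y n → _) := by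
  classical
  intro f g h
  funext i
  have h1 := DFunLike.congr_fun (F := (∀ (i : ℤ) (T : B), Y i ⟶ T) →+ (∀ (i : ℤ) (T : B), X i ⟶ T))
    h (fun j T => if e : Y j = T then eqToHom e else 0)
  have h2 := congrFun (congrFun h1 i) (Y (i + n))
  change f i ≫ (dite _ _ _) = g i ≫ (dite _ _ _) at h2
  simpa using h2

@[simp] lemma rho_gcomp {n m k : ℤ} (h : n + m = k) (f : GMap X Y n) (g : GMap Y Z m) :
    rho (gcomp h f g) = rho f ≫ rho g := by
  refine AddMonoidHom.ext fun y => ?_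
  funext i T
  change (f i ≫ g (i + n) ≫ eqToHom _) ≫ y (i + k) T = f i ≫ g (i + n) ≫ y (i + n + m) T
  have key : ∀ (a b : ℤ) (e : a = b), eqToHom (congrArg Z e) ≫ y b T = y a T := by
    rintro a _ rfl
    simp
  simp only [Category.assoc]
  rw [key _ _ (show i + n + m = i + k by omega)]

@[simp] lemma rho_gid : rho (gid X) = 𝟙 (GRep.mk X) := by
  refine AddMonoidHom.ext fun y => ?_
  funext i T
  change eqToHom _ ≫ y (i + 0) T = y i T
  have key : ∀ (a b : ℤ) (e : a = b), eqToHom (congrArg X e) ≫ y b T = y a T := by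
    rintro a _ rfl
    simp
  exact key _ _ (add_zero i).symm

@[simp] lemma rho_zero {n : ℤ} : rho (0 : GMap X Y n) = 0 := by
  refine AddMonoidHom.ext fun y => ?_
  funext i T
  exact Limits.zero_comp

@[simp] lemma rho_add {n : ℤ} (f g : GMap X Y n) : rho (f + g) = rho f + rho g := by
  refine AddMonoidHom.ext fun y => ?_
  funext i T
  exact Preadditive.add_comp _ _ _ _ _ _

/-- `rho` as a homomorphism of additive groups. -/
def rhoHom (X Y : GradedObj B) (n : ℤ) : GMap X Y n →+ (GRep.mk X ⟶ GRep.mk Y) where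
  toFun := rho
  map_zero' := rho_zero
  map_add' := rho_add

@[simp] lemma rho_sub {n : ℤ} (f g : GMap X Y n) : rho (f - g) = rho f - rho g :=
  map_sub (rhoHom X Y n) f g

@[simp] lemma rho_neg {n : ℤ} (f : GMap X Y n) : rho (-f) = -rho f :=
  map_neg (rhoHom X Y n) f

@[simp] lemma rho_zsmul {n : ℤ} (a : ℤ) (f : GMap X Y n) : rho (a • f) = a • rho f :=
  map_zsmul (rhoHom X Y n) a f

lemma rho_gdelta_zero (dX : GMap X X 1) (dY : GMap Y Y 1) (h : (0 : ℤ) + 1 = 1)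
    (f : GMap X Y 0) : rho (gdelta dX dY h f) = rho f ≫ rho dY - rho dX ≫ rho f := by
  simp [gdelta]

lemma rho_gdelta_neg_one (dX : GMap X X 1) (dY : GMap Y Y 1) (h : (-1 : ℤ) + 1 = 0)
    (f : GMap X Y (-1)) : rho (gdelta dX dY h f) = rho f ≫ rho dY + rho dX ≫ rho f := by
  simp [gdelta]

end Representation

lemma one_add_one_eq : (1 : ℤ) + 1 = 2 := rfl

lemma zero_add_one_eq : (0 : ℤ) + 1 = 1 := rfl

lemma neg_one_add_one_eq : (-1 : ℤ) + 1 = 0 := rfl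

lemma zero_add_zero_eq : (0 : ℤ) + 0 = 0 := rfl

section Functor

variable {B C : Type*} [Category B] [Category C]

lemma chainComp_succ' (X : ℕ → B) (f : ∀ i, X i ⟶ X (i + 1)) (n : ℕ) :
    chainComp X f (n + 1) =
      f 0 ≫ (chainComp (fun i => X (i + 1)) (fun i => f (i + 1)) n : X (0 + 1) ⟶ X (n + 1)) := by
  induction n with
  | zero => simp [chainComp]
  | succ n ih =>
    rw [chainComp, ih, Category.assoc]
    rfl

variable (F : B ⥤ C) {X Y Z : GradedObj B}

@[simp] lemma Fmap_gcomp {p q r : ℤ} (h : p + q = r) (f : GMap X Y p) (g : GMap Y Z q) :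
    Fmap F (gcomp h f g) = gcomp h (Fmap F f) (Fmap F g) := by
  funext i
  simp [Fmap, gcomp, eqToHom_map]

@[simp] lemma Fmap_gid : Fmap F (gid X) = gid (Fgr F X) := by
  funext i
  simp [Fmap, gid, eqToHom_map]

lemma exists_Fmap_eq [F.Full] {p : ℤ} (f : GMap (Fgr F X) (Fgr F Y) p) :
    ∃ g : GMap X Y p, Fmap F g = f :=
  ⟨fun i => F.preimage (f i), funext fun i => F.map_preimage (f i)⟩

end Functor

section KernelPowers

variable {B C : Type*} [Category B] [Category C] [Preadditive C]

/-- Morphisms that factor as `k` composable `F`-killed morphisms followed by any morphism. -/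
inductive IsKerComp (F : B ⥤ C) : ℕ → ∀ {X Y : B}, (X ⟶ Y) → Prop
  | zero {X Y : B} (f : X ⟶ Y) : IsKerComp F 0 f
  | succ {k : ℕ} {X Y Z : B} (u : X ⟶ Y) (g : Y ⟶ Z) (hu : F.map u = 0)
      (hg : IsKerComp F k g) : IsKerComp F (k + 1) (u ≫ g)

variable {F : B ⥤ C}

lemma IsKerComp.comp {k : ℕ} {X Y Z : B} {f : X ⟶ Y} (hf : IsKerComp F k f) (g : Y ⟶ Z) :
    IsKerComp F k (f ≫ g) := by
  induction hf with
  | zero f => exact .zero _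
  | succ u f hu _ ih => rw [Category.assoc]; exact .succ u _ hu (ih g)

lemma IsKerComp.comp_of_map_eq_zero {k : ℕ} {X Y Z : B} {f : X ⟶ Y} (hf : IsKerComp F k f)
    {g : Y ⟶ Z} (hg : F.map g = 0) : IsKerComp F (k + 1) (f ≫ g) := by
  induction hf with
  | zero f =>
    rw [← Category.comp_id (f ≫ g)]
    exact .succ _ _ (by simp [hg]) (.zero _)
  | succ u f hu _ ih => rw [Category.assoc]; exact .succ u _ hu (ih hg)

lemma IsKerComp.exists_chainComp {k : ℕ} {X Y : B} {f : X ⟶ Y} (hf : IsKerComp F k f) :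
    ∃ (W : ℕ → B) (w : ∀ i, W i ⟶ W (i + 1)) (a : X ⟶ W 0) (b : W k ⟶ Y),
      (∀ i, i < k → F.map (w i) = 0) ∧ f = a ≫ chainComp W w k ≫ b := by
  induction hf with
  | @zero X Y f =>
    exact ⟨fun _ => X, fun _ => 𝟙 X, 𝟙 X, f, by simp, by simp [chainComp]⟩
  | @succ k X Y Z u g hu _ ih =>
    obtain ⟨W, w, a, b, hw, rfl⟩ := ih
    refine ⟨fun i => Nat.casesOn i X W, fun i => Nat.casesOn i (u ≫ a) w, 𝟙 X, b, ?_, ?_⟩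
    · rintro (_ | i) hi
      · simp [hu]
      · exact hw i (by omega)
    · rw [chainComp_succ']
      simp

variable [Preadditive B]

lemma IsKerComp.eq_zero {n : ℕ} (hF : KerPow F n) {X Y : B} {f : X ⟶ Y}
    (hf : IsKerComp F n f) : f = 0 := by
  obtain ⟨W, w, a, b, hw, rfl⟩ := hf.exists_chainComp
  simp [hF W w hw]

variable (F) in
/-- The morphisms in the `k`-th power of the kernel ideal of `F`. -/
def kerIdeal (k : ℕ) (X Y : B) : AddSubgroup (X ⟶ Y) :=
  AddSubgroup.closure {f | IsKerComp F k f}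

lemma comp_mem_kerIdeal {k : ℕ} {X Y Z : B} {f : X ⟶ Y} (hf : f ∈ kerIdeal F k X Y)
    (g : Y ⟶ Z) : f ≫ g ∈ kerIdeal F k X Z := by
  induction hf using AddSubgroup.closure_induction with
  | mem f hf => exact AddSubgroup.subset_closure (hf.comp g)
  | zero => simp [zero_mem]
  | add f f' _ _ h h' => rw [Preadditive.add_comp]; exact add_mem h h'
  | neg f _ h => rw [Preadditive.neg_comp]; exact neg_mem h

lemma comp_mem_kerIdeal_succ {k : ℕ} {X Y Z : B} {f : X ⟶ Y} (hf : f ∈ kerIdeal F k X Y)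
    {g : Y ⟶ Z} (hg : F.map g = 0) : f ≫ g ∈ kerIdeal F (k + 1) X Z := by
  induction hf using AddSubgroup.closure_induction with
  | mem f hf => exact AddSubgroup.subset_closure (hf.comp_of_map_eq_zero hg)
  | zero => simp [zero_mem]
  | add f f' _ _ h h' => rw [Preadditive.add_comp]; exact add_mem h h'
  | neg f _ h => rw [Preadditive.neg_comp]; exact neg_mem h

lemma mem_kerIdeal_one {X Y : B} {f : X ⟶ Y} (hf : F.map f = 0) : f ∈ kerIdeal F 1 X Y := by
  rw [← Category.comp_id f]
  exact AddSubgroup.subset_closure (.succ f _ hf (.zero _))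

lemma map_eq_zero_of_mem_kerIdeal [F.Additive] {k : ℕ} {X Y : B} {f : X ⟶ Y}
    (hf : f ∈ kerIdeal F (k + 1) X Y) : F.map f = 0 := by
  induction hf using AddSubgroup.closure_induction with
  | mem f hf => cases hf with | succ u g hu _ => simp [hu]
  | zero => simp
  | add f f' _ _ h h' => simp [h, h']
  | neg f _ h => simp [h]

lemma eq_zero_of_mem_kerIdeal {n : ℕ} (hF : KerPow F n) {X Y : B} {f : X ⟶ Y}
    (hf : f ∈ kerIdeal F n X Y) : f = 0 := by
  induction hf using AddSubgroup.closure_induction with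
  | mem f hf => exact hf.eq_zero hF
  | zero => rfl
  | add f f' _ _ h h' => simp [h, h']
  | neg f _ h => simp [h]

variable {X Y Z : GradedObj B}

variable (F) in
/-- The graded maps of degree `m` with components in the `k`-th power of the kernel of `F`. -/
def gker (k : ℕ) (X Y : GradedObj B) (m : ℤ) : AddSubgroup (GMap X Y m) where
  carrier := {f | ∀ i, f i ∈ kerIdeal F k _ _}
  zero_mem' _ := zero_mem _
  add_mem' hf hg i := add_mem (hf i) (hg i)
  neg_mem' hf i := neg_mem (hf i)

lemma gcomp_mem_gker {k : ℕ} {p q r : ℤ} (h : p + q = r) {f : GMap X Y p}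
    (hf : f ∈ gker F k X Y p) (g : GMap Y Z q) : gcomp h f g ∈ gker F k X Z r :=
  fun i => comp_mem_kerIdeal (hf i) _

lemma gcomp_mem_gker_succ {k : ℕ} {p q r : ℤ} (h : p + q = r) {f : GMap X Y p}
    (hf : f ∈ gker F k X Y p) {g : GMap Y Z q} (hg : Fmap F g = 0) :
    gcomp h f g ∈ gker F (k + 1) X Z r := fun i =>
  comp_mem_kerIdeal_succ (hf i) (by
    rw [F.map_comp, show F.map (g (i + p)) = 0 from congrFun hg _, Limits.zero_comp])

lemma mem_gker_one {p : ℤ} {f : GMap X Y p} (hf : Fmap F f = 0) : f ∈ gker F 1 X Y p :=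
  fun i => mem_kerIdeal_one (congrFun hf i)

lemma Fmap_eq_zero_of_mem_gker [F.Additive] {k : ℕ} {p : ℤ} {f : GMap X Y p}
    (hf : f ∈ gker F (k + 1) X Y p) : Fmap F f = 0 :=
  funext fun i => map_eq_zero_of_mem_kerIdeal (hf i)

lemma eq_zero_of_mem_gker {n : ℕ} (hF : KerPow F n) {p : ℤ} {f : GMap X Y p}
    (hf : f ∈ gker F n X Y p) : f = 0 :=
  funext fun i => eq_zero_of_mem_kerIdeal hF (hf i)

variable (F) [F.Additive]

@[simp] lemma Fmap_add {p : ℤ} (f g : GMap X Y p) : Fmap F (f + g) = Fmap F f + Fmap F g :=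
  funext fun _ => F.map_add

@[simp] lemma Fmap_sub {p : ℤ} (f g : GMap X Y p) : Fmap F (f - g) = Fmap F f - Fmap F g :=
  funext fun _ => F.map_sub

@[simp] lemma Fmap_zsmul {p : ℤ} (a : ℤ) (f : GMap X Y p) :
    Fmap F (a • f) = a • Fmap F f :=
  funext fun _ => F.map_zsmul

@[simp] lemma Fmap_gdelta {p q : ℤ} (dX : GMap X X 1) (dY : GMap Y Y 1) (h : p + 1 = q)
    (f : GMap X Y p) : Fmap F (gdelta dX dY h f) = gdelta (Fmap F dX) (Fmap F dY) h (Fmap F f) := by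
  simp [gdelta]

end KernelPowers

section Contractions

variable {B : Type*} [Category B] [Preadditive B] {X Y : GradedObj B}

/-- The matrix `((H, L), (f', -K))` contracts the cone of `f : (X, dX) → (Y, dY)`. -/
structure IsConeContraction (dX : GMap X X 1) (dY : GMap Y Y 1) (f : GMap X Y 0)
    (H : GMap X X (-1)) (L : GMap X Y (-2)) (f' : GMap Y X 0) (K : GMap Y Y (-1)) : Prop where
  xx : rho dX ≫ rho H + rho H ≫ rho dX + rho f ≫ rho f' = 𝟙 _
  xy : rho dX ≫ rho L - rho f ≫ rho K + rho H ≫ rho f - rho L ≫ rho dY = 0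
  yx : rho f' ≫ rho dX - rho dY ≫ rho f' = 0
  yy : rho dY ≫ rho K + rho K ≫ rho dY + rho f' ≫ rho f = 𝟙 _

lemma IsHomotopyEquivPair.exists_isConeContraction {dX : GMap X X 1} {dY : GMap Y Y 1}
    {f : GMap X Y 0} {f' : GMap Y X 0} (hf : IsHomotopyEquivPair dX dY f f') :
    ∃ (H : GMap X X (-1)) (L : GMap X Y (-2)) (K : GMap Y Y (-1)),
      IsConeContraction dX dY f H L f' K := by
  obtain ⟨h1, h2, ⟨H, hH⟩, ⟨K, hK⟩⟩ := hf
  replace h1 := congrArg rho h1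
  replace h2 := congrArg rho h2
  replace hH := congrArg rho hH
  replace hK := congrArg rho hK
  simp only [rho_gdelta_zero, rho_gdelta_neg_one, rho_zero, rho_sub, rho_gid, rho_gcomp]
    at h1 h2 hH hK
  let N : GMap X Y (-1) := gcomp (by omega) H f - gcomp (by omega) f K
  have eN : rho N = rho H ≫ rho f - rho f ≫ rho K := by simp [N]
  have hN : rho N ≫ rho dY = -(rho dX ≫ rho N) := by
    have e1 : (rho H ≫ rho dX + rho dX ≫ rho H) ≫ rho f
        - rho f ≫ (rho K ≫ rho dY + rho dY ≫ rho K) = 0 := by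
      rw [hH, hK]
      simp
    rw [sub_eq_zero] at h1
    rw [eq_neg_iff_add_eq_zero, eN, ← e1]
    simp only [Preadditive.sub_comp, Preadditive.comp_sub, Preadditive.add_comp,
      Preadditive.comp_add, Category.assoc, h1, reassoc_of% h1]
    abel
  refine ⟨H, -gcomp (by omega) H N, K + gcomp (by omega) f' N, ?_, ?_, h2, ?_⟩
  · rw [add_comm (rho dX ≫ rho H), hH]
    abel
  · have e : rho dX ≫ rho H = 𝟙 _ - rho f ≫ rho f' - rho H ≫ rho dX := by
      rw [← hH]
      abel
    simp only [rho_add, rho_neg, rho_gcomp, Preadditive.comp_add, Preadditive.comp_neg,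
      Preadditive.neg_comp, Category.assoc, hN, reassoc_of% e, Preadditive.sub_comp,
      Category.id_comp]
    rw [eN]
    abel
  · have e : rho dY ≫ rho K = 𝟙 _ - rho f' ≫ rho f - rho K ≫ rho dY := by
      rw [← hK]
      abel
    rw [sub_eq_zero] at h2
    simp only [rho_add, rho_gcomp, Preadditive.comp_add, Preadditive.add_comp, Category.assoc,
      hN, e, ← reassoc_of% h2, Preadditive.comp_neg]
    abel

lemma IsHomotopyEquivPair.symm {dX : GMap X X 1} {dY : GMap Y Y 1}
    {f : GMap X Y 0} {g : GMap Y X 0}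
    (h : IsHomotopyEquivPair dX dY f g) : IsHomotopyEquivPair dY dX g f :=
  ⟨h.2.1, h.1, h.2.2.2, h.2.2.1⟩

end Contractions

section Lifting

variable {B C : Type*} [Category B] [Preadditive B] [Category C] [Preadditive C]
  {F : B ⥤ C} [F.Additive] {X Y : GradedObj B}

lemma exists_better_lift {dX : GMap X X 1} {dY : GMap Y Y 1} {f : GMap X Y 0}
    (hdY : gcomp one_add_one_eq dY dY = 0)
    {H : GMap X X (-1)} {L : GMap X Y (-2)} {f' : GMap Y X 0} {K : GMap Y Y (-1)}
    (hc : IsConeContraction (Fmap F dX) (Fmap F dY) (Fmap F f) (Fmap F H) (Fmap F L) (Fmap F f')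
      (Fmap F K)) {k : ℕ}
    (hr : gcomp one_add_one_eq dX dX ∈ gker F (k + 1) X X 2)
    (hs : gdelta dX dY zero_add_one_eq f ∈ gker F (k + 1) X Y 1) :
    ∃ (dX' : GMap X X 1) (g : GMap X Y 0), Fmap F dX' = Fmap F dX ∧ Fmap F g = Fmap F f ∧
      gcomp one_add_one_eq dX' dX' ∈ gker F (k + 2) X X 2 ∧
      gdelta dX' dY zero_add_one_eq g ∈ gker F (k + 2) X Y 1 := by
  set r := gcomp one_add_one_eq dX dX with hr_def
  set s := gdelta dX dY zero_add_one_eq f with hs_def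
  have er : rho r = rho dX ≫ rho dX := by simp [hr_def]
  have es : rho s = rho f ≫ rho dY - rho dX ≫ rho f := by rw [hs_def, rho_gdelta_zero]
  have eδ : rho dY ≫ rho dY = 0 := by simpa using congrArg rho hdY
  let a : GMap X X 1 := gcomp (by omega) r H - gcomp (by omega) s f'
  let b : GMap X Y 0 := gcomp (by omega) r L + gcomp (by omega) s K
  have ea : rho a = rho r ≫ rho H - rho s ≫ rho f' := by simp [a]
  have eb : rho b = rho r ≫ rho L + rho s ≫ rho K := by simp [b]
  have ha : a ∈ gker F (k + 1) X X 1 := sub_mem (gcomp_mem_gker _ hr _) (gcomp_mem_gker _ hs _)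
  have hb : b ∈ gker F (k + 1) X Y 0 := add_mem (gcomp_mem_gker _ hr _) (gcomp_mem_gker _ hs _)
  have Fa := Fmap_eq_zero_of_mem_gker ha
  have Fb := Fmap_eq_zero_of_mem_gker hb
  let nxx : GMap X X 0 := gid X - (gcomp (by omega) dX H + gcomp (by omega) H dX
    + gcomp (by omega) f f')
  let nxy : GMap X Y (-1) := gcomp (by omega) dX L - gcomp (by omega) f K
    + gcomp (by omega) H f - gcomp (by omega) L dY
  let nyx : GMap Y X 1 := gcomp (by omega) f' dX - gcomp (by omega) dY f'
  let nyy : GMap Y Y 0 := gid Y - (gcomp (by omega) dY K + gcomp (by omega) K dY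
    + gcomp (by omega) f' f)
  have hxx : Fmap F nxx = 0 := rho_injective (by simp [nxx, hc.xx])
  have hxy : Fmap F nxy = 0 := rho_injective (by simp [nxy, hc.xy])
  have hyx : Fmap F nyx = 0 := rho_injective (by simp [nyx, hc.yx])
  have hyy : Fmap F nyy = 0 := rho_injective (by simp [nyy, hc.yy])
  refine ⟨dX - a, f - b, by simp [Fa], by simp [Fb], ?_, ?_⟩
  · have : gcomp one_add_one_eq (dX - a) (dX - a)
        = gcomp (by omega) r nxx + gcomp (by omega) s nyx + gcomp (by omega) a a := by
      apply rho_injective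
      simp only [rho_gcomp, rho_sub, rho_add, nxx, nyx, rho_gid, Preadditive.comp_add,
        Preadditive.comp_sub, Preadditive.sub_comp, Category.comp_id]
      simp only [ea, er, es, Preadditive.comp_sub, Preadditive.sub_comp, Category.assoc,
        reassoc_of% eδ, Limits.comp_zero, Limits.zero_comp]
      abel
    rw [this]
    exact add_mem (add_mem (gcomp_mem_gker_succ _ hr hxx) (gcomp_mem_gker_succ _ hs hyx))
      (gcomp_mem_gker_succ _ ha Fa)
  · have : gdelta (dX - a) dY zero_add_one_eq (f - b)
        = gcomp (by omega) s nyy + gcomp (by omega) r nxy - gcomp (by omega) a b := by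
      apply rho_injective
      rw [rho_gdelta_zero]
      simp only [rho_gcomp, rho_sub, rho_add, nyy, nxy, rho_gid, Preadditive.comp_add,
        Preadditive.comp_sub, Preadditive.sub_comp, Category.comp_id]
      simp only [ea, eb, er, es, Preadditive.comp_add, Preadditive.add_comp,
        Preadditive.comp_sub, Preadditive.sub_comp, Category.assoc, reassoc_of% eδ,
        Limits.comp_zero, Limits.zero_comp]
      abel
    rw [this]
    exact sub_mem (add_mem (gcomp_mem_gker_succ _ hs hyy) (gcomp_mem_gker_succ _ hr hxy))
      (gcomp_mem_gker_succ _ ha Fb)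

variable {n : ℕ}

lemma exists_right_inverse_of_Fmap_eq_gid (hn : 1 ≤ n) (hF : KerPow F n) {u : GMap X X 0}
    (hu : Fmap F u = gid _) :
    ∃ v : GMap X X 0, gcomp zero_add_zero_eq u v = gid X := by
  have key : ∀ k : ℕ, ∃ v : GMap X X 0,
      gid X - gcomp zero_add_zero_eq u v ∈ gker F (k + 1) X X 0 := by
    intro k
    induction k with
    | zero =>
      refine ⟨gid X, mem_gker_one (rho_injective ?_)⟩
      simp [hu]
    | succ k ih =>
      obtain ⟨v, hv⟩ := ih
      set w := gid X - gcomp zero_add_zero_eq u v with hw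
      refine ⟨v + gcomp (by omega) v w, ?_⟩
      have e : gid X - gcomp zero_add_zero_eq u (v + gcomp (by omega) v w)
          = gcomp (by omega) w w := by
        apply rho_injective
        simp [hw]
        abel
      rw [e]
      exact gcomp_mem_gker_succ _ hv (Fmap_eq_zero_of_mem_gker hv)
  obtain ⟨k, rfl⟩ := Nat.exists_eq_add_of_le' hn
  obtain ⟨v, hv⟩ := key k
  exact ⟨v, (sub_eq_zero.1 (eq_zero_of_mem_gker hF hv)).symm⟩

lemma exists_inverse_of_Fmap_eq_gid (hn : 1 ≤ n) (hF : KerPow F n) {u : GMap X X 0}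
    (hu : Fmap F u = gid _) :
    ∃ v : GMap X X 0, Fmap F v = gid _ ∧
      gcomp zero_add_zero_eq u v = gid X ∧
      gcomp zero_add_zero_eq v u = gid X := by
  obtain ⟨v, hv⟩ := exists_right_inverse_of_Fmap_eq_gid hn hF hu
  have hFv : Fmap F v = gid _ := by
    have := congrArg rho (congrArg (Fmap F) hv)
    apply rho_injective
    simpa [hu] using this
  obtain ⟨w, hw⟩ := exists_right_inverse_of_Fmap_eq_gid hn hF hFv
  refine ⟨v, hFv, hv, ?_⟩
  have ew : w = u := by
    apply rho_injective
    have e1 : rho u ≫ rho v = 𝟙 _ := by simpa using congrArg rho hv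
    have e2 : rho v ≫ rho w = 𝟙 _ := by simpa using congrArg rho hw
    calc rho w = (rho u ≫ rho v) ≫ rho w := by rw [e1, Category.id_comp]
      _ = rho u := by rw [Category.assoc, e2, Category.comp_id]
  rwa [ew] at hw

variable [F.Full]

lemma exists_lift_mem_gker {dY : GMap Y Y 1}
    (hdY : gcomp one_add_one_eq dY dY = 0)
    {d : GMap (Fgr F X) (Fgr F X) 1} (hd : gcomp one_add_one_eq d d = 0)
    {φ : GMap (Fgr F X) (Fgr F Y) 0} {φ' : GMap (Fgr F Y) (Fgr F X) 0}
    (hφ : IsHomotopyEquivPair d (Fmap F dY) φ φ') (k : ℕ) :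
    ∃ (dX : GMap X X 1) (f : GMap X Y 0), Fmap F dX = d ∧ Fmap F f = φ ∧
      gcomp one_add_one_eq dX dX ∈ gker F (k + 1) X X 2 ∧
      gdelta dX dY zero_add_one_eq f ∈ gker F (k + 1) X Y 1 := by
  induction k with
  | zero =>
    obtain ⟨dX, rfl⟩ := exists_Fmap_eq F d
    obtain ⟨f, rfl⟩ := exists_Fmap_eq F φ
    refine ⟨dX, f, rfl, rfl, mem_gker_one ?_, mem_gker_one ?_⟩
    · rw [Fmap_gcomp, hd]
    · rw [Fmap_gdelta, hφ.1]
  | succ k ih =>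
    obtain ⟨dX, f, rfl, rfl, hr, hs⟩ := ih
    obtain ⟨H, L, K, hc⟩ := hφ.exists_isConeContraction
    obtain ⟨H, rfl⟩ := exists_Fmap_eq F H
    obtain ⟨L, rfl⟩ := exists_Fmap_eq F L
    obtain ⟨K, rfl⟩ := exists_Fmap_eq F K
    obtain ⟨f', rfl⟩ := exists_Fmap_eq F φ'
    exact exists_better_lift hdY hc hr hs

lemma exists_lift (hn : 1 ≤ n) (hF : KerPow F n) {dY : GMap Y Y 1}
    (hdY : gcomp one_add_one_eq dY dY = 0)
    {d : GMap (Fgr F X) (Fgr F X) 1} (hd : gcomp one_add_one_eq d d = 0)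
    {φ : GMap (Fgr F X) (Fgr F Y) 0} {φ' : GMap (Fgr F Y) (Fgr F X) 0}
    (hφ : IsHomotopyEquivPair d (Fmap F dY) φ φ') :
    ∃ (dX : GMap X X 1) (f : GMap X Y 0), Fmap F dX = d ∧ Fmap F f = φ ∧
      gcomp one_add_one_eq dX dX = 0 ∧
      gdelta dX dY zero_add_one_eq f = 0 := by
  obtain ⟨k, rfl⟩ := Nat.exists_eq_add_of_le' hn
  obtain ⟨dX, f, h1, h2, hr, hs⟩ := exists_lift_mem_gker hdY hd hφ k
  exact ⟨dX, f, h1, h2, eq_zero_of_mem_gker hF hr, eq_zero_of_mem_gker hF hs⟩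

/-- A cochain map whose image is homotopic to the identity is homotopic to an isomorphism of
complexes whose image is the identity. -/
lemma exists_strict_iso (hn : 1 ≤ n) (hF : KerPow F n) {d₁ d₂ : GMap X X 1}
    (h₁ : gcomp one_add_one_eq d₁ d₁ = 0)
    (h₂ : gcomp one_add_one_eq d₂ d₂ = 0) {u : GMap X X 0}
    (hu : gdelta d₁ d₂ zero_add_one_eq u = 0)
    {h : GMap (Fgr F X) (Fgr F X) (-1)}
    (hh : gdelta (Fmap F d₁) (Fmap F d₂) neg_one_add_one_eq h
      = gid _ - Fmap F u) :
    ∃ (w v : GMap X X 0) (H : GMap X X (-1)), Fmap F w = gid _ ∧ Fmap F v = gid _ ∧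
      rho w ≫ rho v = 𝟙 _ ∧ rho v ≫ rho w = 𝟙 _ ∧
      rho w ≫ rho d₂ = rho d₁ ≫ rho w ∧ rho v ≫ rho d₁ = rho d₂ ≫ rho v ∧
      rho H ≫ rho d₂ + rho d₁ ≫ rho H = rho w - rho u := by
  obtain ⟨H, rfl⟩ := exists_Fmap_eq F h
  let w := u + gdelta d₁ d₂ neg_one_add_one_eq H
  have hw : Fmap F w = gid _ := by simp [w, hh]
  obtain ⟨v, hFv, hwv, hvw⟩ := exists_inverse_of_Fmap_eq_gid hn hF hw
  have ewv : rho w ≫ rho v = 𝟙 _ := by simpa using congrArg rho hwv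
  have evw : rho v ≫ rho w = 𝟙 _ := by simpa using congrArg rho hvw
  have e₁ : rho d₁ ≫ rho d₁ = 0 := by simpa using congrArg rho h₁
  have e₂ : rho d₂ ≫ rho d₂ = 0 := by simpa using congrArg rho h₂
  have eu : rho u ≫ rho d₂ = rho d₁ ≫ rho u := by
    simpa [rho_gdelta_zero, sub_eq_zero] using congrArg rho hu
  have ew : rho w ≫ rho d₂ = rho d₁ ≫ rho w := by
    simp [w, rho_gdelta_neg_one, eu, e₂, reassoc_of% e₁]
  refine ⟨w, v, H, hw, hFv, ewv, evw, ew, ?_, by simp [w, rho_gdelta_neg_one]⟩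
  calc rho v ≫ rho d₁ = rho v ≫ (rho d₁ ≫ rho w) ≫ rho v := by simp [ewv]
    _ = rho d₂ ≫ rho v := by rw [← ew]; simp [reassoc_of% evw]

/-- A homotopy inverse in the image lifts to a cochain map. -/
lemma exists_lift_inverse (hn : 1 ≤ n) (hF : KerPow F n) {dX : GMap X X 1} {dY : GMap Y Y 1}
    (hdX : gcomp one_add_one_eq dX dX = 0)
    (hdY : gcomp one_add_one_eq dY dY = 0) {f : GMap X Y 0}
    (hf : gdelta dX dY zero_add_one_eq f = 0) {φ' : GMap (Fgr F Y) (Fgr F X) 0}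
    (hφ : IsHomotopyEquivPair (Fmap F dX) (Fmap F dY) (Fmap F f) φ') :
    ∃ g : GMap Y X 0, Fmap F g = φ' ∧
      gdelta dY dX zero_add_one_eq g = 0 := by
  obtain ⟨d', θ, hd', rfl, hd'd', hθ⟩ := exists_lift hn hF hdX
    (by rw [← Fmap_gcomp, hdY]; exact funext fun _ => F.map_zero _ _)
    hφ.symm
  have ef : rho f ≫ rho dY = rho dX ≫ rho f := by
    simpa [rho_gdelta_zero, sub_eq_zero] using congrArg rho hf
  have eθ : rho θ ≫ rho dX = rho d' ≫ rho θ := by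
    simpa [rho_gdelta_zero, sub_eq_zero] using congrArg rho hθ
  obtain ⟨K, hK⟩ := hφ.2.2.2
  obtain ⟨w, v, -, -, hv, -, -, -, ev, -⟩ := exists_strict_iso (F := F) hn hF hd'd' hdY
    (u := gcomp (by omega) θ f) (h := K)
    (rho_injective (by simp [rho_gdelta_zero, ef, reassoc_of% eθ]))
    (by rw [hd', hK, Fmap_gcomp])
  refine ⟨gcomp (by omega) v θ, rho_injective (by simp [hv]), rho_injective ?_⟩
  simp [rho_gdelta_zero, eθ, reassoc_of% ev]

lemma exists_isHomotopyEquivPair (hn : 1 ≤ n) (hF : KerPow F n) {dX : GMap X X 1}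
    {dY : GMap Y Y 1} (hdX : gcomp one_add_one_eq dX dX = 0)
    (hdY : gcomp one_add_one_eq dY dY = 0) {f : GMap X Y 0}
    (hf : gdelta dX dY zero_add_one_eq f = 0) {φ' : GMap (Fgr F Y) (Fgr F X) 0}
    (hφ : IsHomotopyEquivPair (Fmap F dX) (Fmap F dY) (Fmap F f) φ') :
    ∃ g : GMap Y X 0, IsHomotopyEquivPair dX dY f g := by
  obtain ⟨g, rfl, hg⟩ := exists_lift_inverse hn hF hdX hdY hf hφ
  have ef : rho f ≫ rho dY = rho dX ≫ rho f := by
    simpa [rho_gdelta_zero, sub_eq_zero] using congrArg rho hf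
  have eg : rho g ≫ rho dX = rho dY ≫ rho g := by
    simpa [rho_gdelta_zero, sub_eq_zero] using congrArg rho hg
  obtain ⟨-, -, ⟨H, hH⟩, K, hK⟩ := hφ
  obtain ⟨w, v, H, -, -, ewv, -, -, ev, eH⟩ := exists_strict_iso (F := F) hn hF hdX hdX
    (u := gcomp (by omega) f g) (h := H)
    (rho_injective (by simp [rho_gdelta_zero, eg, reassoc_of% ef])) (by rw [hH, Fmap_gcomp])
  obtain ⟨w', v', K, -, -, -, evw', -, ev', eK⟩ := exists_strict_iso (F := F) hn hF hdY hdY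
    (u := gcomp (by omega) g f) (h := K)
    (rho_injective (by simp [rho_gdelta_zero, ef, reassoc_of% eg])) (by rw [hK, Fmap_gcomp])
  rw [rho_gcomp] at eH eK
  let g' : GMap Y X 0 := gcomp (by omega) g v
  have eg' : rho g' = rho g ≫ rho v := by simp [g']
  let q : GMap Y Y 0 := gid Y - gcomp (by omega) g' f
  have hq : rho q = 𝟙 _ - rho g ≫ rho v ≫ rho f := by simp [q, eg']
  have eqd : rho q ≫ rho dY = rho dY ≫ rho q := by
    simp [hq, ef, reassoc_of% eg, reassoc_of% ev]
  refine ⟨g', hf, rho_injective ?_, ⟨gcomp (by omega) H v, rho_injective ?_⟩,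
    gcomp (show (0 : ℤ) + -1 = -1 by omega) v' (gcomp (by omega) K q)
      + gcomp (show (0 : ℤ) + -1 = -1 by omega) (gcomp (by omega) v' g)
        (gcomp (show (-1 : ℤ) + 0 = -1 by omega) H (gcomp (by omega) v f)), rho_injective ?_⟩
  · simp [rho_gdelta_zero, eg', ev, reassoc_of% eg]
  · calc rho (gdelta dX dX _ (gcomp _ H v))
          = (rho H ≫ rho dX + rho dX ≫ rho H) ≫ rho v := by simp [rho_gdelta_neg_one, ev]
      _ = _ := by rw [eH]; simp [eg', ewv]
  · calc rho (gdelta dY dY _ _)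
          = rho v' ≫ (rho K ≫ rho dY + rho dY ≫ rho K) ≫ rho q
            + rho v' ≫ rho g ≫ (rho H ≫ rho dX + rho dX ≫ rho H) ≫ rho v ≫ rho f := by
          simp only [rho_gdelta_neg_one, rho_add, rho_gcomp, Preadditive.add_comp,
            Preadditive.comp_add, Category.assoc, ef, eqd, reassoc_of% ev, reassoc_of% ev',
            reassoc_of% eg]
          abel
      _ = _ := by
          rw [eH, eK]
          simp [hq, eg', reassoc_of% ewv, evw', reassoc_of% evw']
          abel

end Lifting

/-- Proposition `psi` / Corollary `corpsi`: for a full additive `F` with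
`Ker(F)ⁿ = 0`, every lift of `(C,d)` along `K(F)` comes, up to homotopy equivalence over
the structure map, from a differential on the fixed graded lift `C̄`; and two lifted
differentials give the same isomorphism class of lift along `K(F)` iff there is a strict
isomorphism of complexes between them sent by `F` to a cochain map homotopic to the
identity. -/
theorem statement16 {B C : Type*} [Category B] [Preadditive B] [Category C] [Preadditive C]
    (F : B ⥤ C) [F.Additive] [F.Full]
    (n : ℕ) (hn : 1 ≤ n) (hF : KerPow F n)
    (Xb : GradedObj B)
    (d : GMap (Fgr F Xb) (Fgr F Xb) 1)
    (hd : gcomp (show (1:ℤ) + 1 = 2 by omega) d d = 0) :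
    -- essential surjectivity on lifts
    (∀ (Yb : GradedObj B) (dYb : GMap Yb Yb 1),
      gcomp (show (1:ℤ) + 1 = 2 by omega) dYb dYb = 0 →
      ∀ (φ : GMap (Fgr F Xb) (Fgr F Yb) 0) (φ' : GMap (Fgr F Yb) (Fgr F Xb) 0),
        IsHomotopyEquivPair d (Fmap F dYb) φ φ' →
        ∃ db : GMap Xb Xb 1, Fmap F db = d ∧
          gcomp (show (1:ℤ) + 1 = 2 by omega) db db = 0 ∧
          ∃ (ψ : GMap Xb Yb 0) (ψ' : GMap Yb Xb 0),
            IsHomotopyEquivPair db dYb ψ ψ' ∧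
            ∃ h : GMap (Fgr F Xb) (Fgr F Yb) (-1),
              gdelta d (Fmap F dYb) (show (-1:ℤ) + 1 = 0 by omega) h = φ - Fmap F ψ) ∧
    -- injectivity on isomorphism classes
    (∀ db db' : GMap Xb Xb 1,
      Fmap F db = d → gcomp (show (1:ℤ) + 1 = 2 by omega) db db = 0 →
      Fmap F db' = d → gcomp (show (1:ℤ) + 1 = 2 by omega) db' db' = 0 →
      ((∃ (u : GMap Xb Xb 0) (v : GMap Xb Xb 0),
          IsHomotopyEquivPair db db' u v ∧
          ∃ h : GMap (Fgr F Xb) (Fgr F Xb) (-1),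
            gdelta d d (show (-1:ℤ) + 1 = 0 by omega) h
              = gid (Fgr F Xb) - Fmap F u) ↔
        (∃ u : GMap Xb Xb 0,
          gcomp (show (0:ℤ) + 1 = 1 by omega) u db'
            = gcomp (show (1:ℤ) + 0 = 1 by omega) db u ∧
          (∃ v : GMap Xb Xb 0,
            gcomp (show (0:ℤ) + 0 = 0 by omega) u v = gid Xb ∧
            gcomp (show (0:ℤ) + 0 = 0 by omega) v u = gid Xb) ∧
          ∃ h : GMap (Fgr F Xb) (Fgr F Xb) (-1),
            gdelta d d (show (-1:ℤ) + 1 = 0 by omega) h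
              = gid (Fgr F Xb) - Fmap F u))) := by

  refine ⟨fun Yb dYb hdY φ φ' hφ => ?_, ?_⟩
  · obtain ⟨db, ψ, rfl, rfl, hdb, hψ⟩ := exists_lift hn hF hdY hd hφ
    obtain ⟨ψ', hψ'⟩ := exists_isHomotopyEquivPair hn hF hdb hdY hψ hφ
    refine ⟨db, rfl, hdb, ψ, ψ', hψ', 0, rho_injective ?_⟩
    simp [rho_gdelta_neg_one]
  · rintro db db' rfl hdb hdb' hdb'2
    constructor
    · rintro ⟨u, v, hu, h, hh⟩
      obtain ⟨w, v, -, hw, -, ewv, evw, ew, -, -⟩ :=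
        exists_strict_iso (F := F) hn hF hdb hdb'2 hu.1 (h := h) (by rw [hdb', hh])
      refine ⟨w, rho_injective (by simpa using ew),
        ⟨v, rho_injective (by simpa using ewv), rho_injective (by simpa using evw)⟩,
        0, rho_injective ?_⟩
      simp [rho_gdelta_neg_one, hw]
    · rintro ⟨u, hu, ⟨v, huv, hvu⟩, h⟩
      have eu : rho u ≫ rho db' = rho db ≫ rho u := by simpa using congrArg rho hu
      have euv : rho u ≫ rho v = 𝟙 _ := by simpa using congrArg rho huv
      have evu : rho v ≫ rho u = 𝟙 _ := by simpa using congrArg rho hvu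
      have ev : rho v ≫ rho db = rho db' ≫ rho v := by
        calc rho v ≫ rho db = rho v ≫ (rho db ≫ rho u) ≫ rho v := by simp [euv]
          _ = rho db' ≫ rho v := by rw [← eu]; simp [reassoc_of% evu]
      refine ⟨u, v, ⟨rho_injective ?_, rho_injective ?_, ⟨0, rho_injective ?_⟩,
        ⟨0, rho_injective ?_⟩⟩, h⟩
      · simp [rho_gdelta_zero, eu]
      · simp [rho_gdelta_zero, ev]
      · simp [rho_gdelta_neg_one, euv]
      · simp [rho_gdelta_neg_one, evu]

end Paper
end

section
/- Let 𝒞, 𝒞′, 𝒟, 𝒟′ be categories and F : 𝒞 → 𝒞′, G : 𝒟 → 𝒟′, H : 𝒞 → 𝒟, H′ : 𝒞′ → 𝒟′ functors satisfying condition (L): (1) there is a natural isomorphism G∘H ≅ H′∘F; (2) F and G are fully faithful; (3) whenever H′(C′) ≅ G(D) for objects C′ of 𝒞′ and D of 𝒟, there exists an object C of 𝒞 with C′ ≅ F(C). Then for every object D of 𝒟 and every object D′ of 𝒟′ with D′ ≅ G(D), there is an equivalence of groupoids L_H(D) ≃ L_{H′}(D′) between the corresponding lift groupoids. -/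
open CategoryTheory

namespace Paper19

/-- A lift of an object `d : 𝒟` along a functor `H : 𝒞 ⥤ 𝒟`: an object of `𝒞` together
with an isomorphism `d ≅ H(C)`. -/
structure Lift {C D : Type*} [Category C] [Category D] (H : C ⥤ D) (d : D) where
  obj : C
  iso : d ≅ H.obj obj

/-- The lift groupoid `L_H(d)`: morphisms `(C,c) → (C₁,c₁)` are the isomorphisms
`u : C → C₁` of `𝒞` with `H(u) ∘ c = c₁`. -/
instance liftCategory {C D : Type*} [Category C] [Category D] (H : C ⥤ D) (d : D) :
    Category (Lift H d) where
  Hom L L' := { u : L.obj ⟶ L'.obj // IsIso u ∧ L.iso.hom ≫ H.map u = L'.iso.hom }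
  id L := ⟨𝟙 L.obj, inferInstance, by simp⟩
  comp u v := ⟨u.1 ≫ v.1,
    by haveI := u.2.1; haveI := v.2.1; infer_instance,
    by rw [H.map_comp, ← Category.assoc, u.2.2, v.2.2]⟩
  id_comp u := Subtype.ext (by simp)
  comp_id u := Subtype.ext (by simp)
  assoc u v w := Subtype.ext (by simp)

section LiftMap

variable {C C' D D' : Type*} [Category C] [Category C'] [Category D] [Category D']
  {F : C ⥤ C'} {G : D ⥤ D'} {H : C ⥤ D} {H' : C' ⥤ D'}

/-- An isomorphism in `C` compatible with the structure isomorphisms induces an isomorphism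
of lifts. -/
def Lift.isoMk {d : D} {L L' : Lift H d} (j : L.obj ≅ L'.obj)
    (w : L.iso.hom ≫ H.map j.hom = L'.iso.hom) : L ≅ L' where
  hom := ⟨j.hom, inferInstance, w⟩
  inv := ⟨j.inv, inferInstance, by rw [← w, Category.assoc, ← H.map_comp]; simp⟩
  hom_inv_id := Subtype.ext j.hom_inv_id
  inv_hom_id := Subtype.ext j.inv_hom_id

/-- The functor between lift groupoids induced by a square of functors commuting up to a natural
isomorphism, together with an isomorphism `d' ≅ G(d)`. -/
def liftMap (α : H ⋙ G ≅ F ⋙ H') {d : D} {d' : D'} (e : d' ≅ G.obj d) :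
    Lift H d ⥤ Lift H' d' where
  obj L := ⟨F.obj L.obj, e ≪≫ G.mapIso L.iso ≪≫ α.app L.obj⟩
  map {L L'} u := ⟨F.map u.1, by have := u.2.1; infer_instance, by
    obtain ⟨u, _, w⟩ := u
    have hα : α.hom.app L.obj ≫ H'.map (F.map u) = G.map (H.map u) ≫ α.hom.app L'.obj :=
      (α.hom.naturality u).symm
    simp [hα, ← w]⟩
  map_id L := Subtype.ext (F.map_id L.obj)
  map_comp u v := Subtype.ext (F.map_comp u.1 v.1)

variable (α : H ⋙ G ≅ F ⋙ H') {d : D} {d' : D'} (e : d' ≅ G.obj d)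

instance liftMap_faithful [F.Faithful] : (liftMap α e).Faithful where
  map_injective h := Subtype.ext (F.map_injective (congrArg Subtype.val h))

instance liftMap_full [F.Full] [F.Faithful] [G.Faithful] : (liftMap α e).Full where
  map_surjective {L L'} v := by
    obtain ⟨v, hv, w⟩ := v
    obtain ⟨u, rfl⟩ := F.map_surjective v
    have : IsIso (F.map u) := hv
    refine ⟨⟨u, isIso_of_reflects_iso u F, G.map_injective ?_⟩, rfl⟩
    have hα : α.hom.app L.obj ≫ H'.map (F.map u) = G.map (H.map u) ≫ α.hom.app L'.obj :=
      (α.hom.naturality u).symm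
    have w' : e.hom ≫ G.map (L.iso.hom ≫ H.map u) ≫ α.hom.app L'.obj =
        e.hom ≫ G.map L'.iso.hom ≫ α.hom.app L'.obj := by
      simpa [liftMap, hα] using w
    exact (cancel_mono (α.hom.app L'.obj)).1 ((cancel_epi e.hom).1 w')

theorem liftMap_essSurj [G.Full] [G.Faithful]
    (h : ∀ c' : C', (H'.obj c' ≅ G.obj d) → ∃ c : C, Nonempty (c' ≅ F.obj c)) :
    (liftMap α e).EssSurj where
  mem_essImage L := by
    obtain ⟨c, ⟨j⟩⟩ := h L.obj (L.iso.symm ≪≫ e)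
    let i : d ≅ H.obj c := G.preimageIso (e.symm ≪≫ L.iso ≪≫ H'.mapIso j ≪≫ (α.app c).symm)
    exact ⟨⟨c, i⟩, ⟨(Lift.isoMk j (by simp [liftMap, i])).symm⟩⟩

end LiftMap

/-- Proposition `eqliftgdn`: a square of functors satisfying condition (L)
induces an equivalence of lift groupoids `L_H(D) ≃ L_{H'}(D')` for every `D` in `𝒟` and
every `D' ≅ G(D)` in `𝒟'`. -/
theorem statement19 {C C' D D' : Type*}
    [Category C] [Category C'] [Category D] [Category D']
    (F : C ⥤ C') (G : D ⥤ D') (H : C ⥤ D) (H' : C' ⥤ D')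
    -- (L)(1): the square commutes up to natural isomorphism
    (α : H ⋙ G ≅ F ⋙ H')
    -- (L)(2): `F` and `G` are fully faithful
    [F.Full] [F.Faithful] [G.Full] [G.Faithful]
    -- (L)(3)
    (h3 : ∀ (c' : C') (dd : D), (H'.obj c' ≅ G.obj dd) → ∃ c : C, Nonempty (c' ≅ F.obj c))
    (dd : D) (d' : D') (e : d' ≅ G.obj dd) :
    Nonempty (Lift H dd ≌ Lift H' d') := by
  have := liftMap_essSurj α e (fun c' => h3 c' dd)
  have : (liftMap α e).IsEquivalence := {}
  exact ⟨(liftMap α e).asEquivalence⟩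

end Paper19
end
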